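/- Let M > N/2 be a positive integer and 0 < β < α be such that 2β + α < π and (M/N) sin(α/2 − β/4) cos(α/2 + 5β/8) − (1 − M/N) cos(α/2 − β/8) > 0. Let μ, λ satisfy 0 < μ ≤ (M/N) sin(α/2 − β/4) cos(α/2 + 5β/8) − (1 − M/N) cos(α/2 − β/8) and λ > μ + 2. Assume mK ≤ β / (4(λ + μ + 2) ln((λ + 2μ + 2)/μ)) and D(Ω) < μK. Then every solution Θ(t) of the second-order Kuramoto system m θ_i''(t) + θ_i'(t) = ω_i + (K/N) Σ_{j=1}^N sin(θ_j(t) − θ_i(t)) with initial conditions D(Θ_M(0)) ≤ π − α − β and D(Θ_M'(0)) < λK achieves the complete frequency synchronization asymptotically: lim_{t→∞} θ_i'(t) = ω for all 1 ≤ i ≤ N, where ω := (1/N) Σ_{i=1}^N ω_i. -/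

import Mathlib

open Real Filter

/-- The diameter `D(X) = max_{i≠j} (xᵢ - xⱼ)` of a vector `X ∈ ℝ^N`
(realized as the supremum of `xᵢ - xⱼ` over all pairs). -/
noncomputable def diam {n : ℕ} (X : Fin n → ℝ) : ℝ :=
  ⨆ p : Fin n × Fin n, (X p.1 - X p.2)

/-- A pair difference never exceeds the diameter. -/
lemma sub_le_diam {n : ℕ} (X : Fin n → ℝ) (i j : Fin n) : X i - X j ≤ diam X :=
  le_ciSup (f := fun p : Fin n × Fin n => X p.1 - X p.2) (Set.finite_range _).bddAbove (i, j)

/-- Exponential relaxation for the differential inequality `m f' + f ≤ C`. -/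
lemma le_add_mul_exp_of_relaxation {m C a b : ℝ} (hm : 0 < m) {f f' : ℝ → ℝ} (hab : a ≤ b)
    (hf : ∀ t, HasDerivAt f (f' t) t) (h : ∀ t ∈ Set.Icc a b, m * f' t + f t ≤ C) :
    f b ≤ C + (f a - C) * exp (-((b - a) / m)) := by
  have hg : ∀ t, HasDerivAt (fun t => (f t - C) * exp (t / m))
      (f' t * exp (t / m) + (f t - C) * (exp (t / m) * (1 / m))) t := fun t =>
    ((hf t).sub_const C).mul (((hasDerivAt_id t).div_const m).exp)
  have hanti : AntitoneOn (fun t => (f t - C) * exp (t / m)) (Set.Icc a b) := by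
    refine antitoneOn_of_deriv_nonpos (convex_Icc a b)
      (fun t _ => (hg t).continuousAt.continuousWithinAt)
      (fun t _ => (hg t).differentiableAt.differentiableWithinAt) fun t ht => ?_
    rw [interior_Icc] at ht
    have h1 := h t (Set.Ioo_subset_Icc_self ht)
    have h2 : f' t * exp (t / m) + (f t - C) * (exp (t / m) * (1 / m))
        = (m * f' t + f t - C) * (exp (t / m) / m) := by field_simp; ring
    rw [(hg t).deriv, h2]
    exact mul_nonpos_of_nonpos_of_nonneg (by linarith) (by positivity)
  have h1 := hanti (Set.left_mem_Icc.2 hab) (Set.right_mem_Icc.2 hab) hab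
  have h2 := mul_le_mul_of_nonneg_right h1 (exp_pos (-(b / m))).le
  simp only [mul_assoc, ← exp_add] at h2
  rw [add_neg_cancel, exp_zero, show a / m + -(b / m) = -((b - a) / m) by ring] at h2
  linarith

/-- A finite family lying below a line of slope `-ε` stays below it as long as every member
touching the line does so with derivative less than `-ε`. -/
lemma forall_le_line_of_deriv_lt {ι : Type*} [Finite ι] {f f' : ι → ℝ → ℝ}
    (hf : ∀ k t, HasDerivAt (f k) (f' k t) t) {a b c ε : ℝ} (h0 : ∀ k, f k a ≤ c)
    (hstep : ∀ t ∈ Set.Ico a b, (∀ k, f k t ≤ c - ε * (t - a)) →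
      ∀ k, f k t = c - ε * (t - a) → f' k t < -ε) :
    ∀ t ∈ Set.Icc a b, ∀ k, f k t ≤ c - ε * (t - a) := by
  have hg : ∀ k t, HasDerivAt (fun t => f k t - (c - ε * (t - a))) (f' k t + ε) t := fun k t =>
    ((hf k t).sub ((((hasDerivAt_id t).sub_const a).const_mul ε).const_sub c)).congr_deriv (by simp)
  have hclosed : IsClosed {t | ∀ k, f k t ≤ c - ε * (t - a)} := by
    simp only [Set.ofPred_forall]
    refine isClosed_iInter fun k => isClosed_le ?_ (by fun_prop)
    exact continuous_iff_continuousAt.2 fun t => (hf k t).continuousAt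
  refine (hclosed.inter isClosed_Icc).Icc_subset_of_forall_mem_nhdsWithin (by simpa using h0) ?_
  rintro t ⟨ht, htab⟩
  change ∀ᶠ s in nhdsWithin t (Set.Ioi t), ∀ k, f k s ≤ c - ε * (s - a)
  refine eventually_all.2 fun k => ?_
  rcases (ht k).lt_or_eq with hlt | heq
  · have := (hg k t).continuousAt.eventually_lt continuousAt_const (sub_neg.2 hlt)
    filter_upwards [nhdsWithin_le_nhds this] with s hs
    linarith
  · have hneg : f' k t + ε < 0 := by linarith [hstep t htab ht k heq]
    have := (hasDerivAt_iff_tendsto_slope.1 (hg k t)).eventually_lt_const hneg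
    filter_upwards [nhdsWithin_mono t (fun s (hs : t < s) => ne_of_gt hs) this,
      self_mem_nhdsWithin] with s hs hts
    rw [slope_def_field, div_lt_iff₀ (sub_pos.2 hts), heq] at hs
    linarith

/-- A continuous function on a half-line avoiding all multiples of `2π` is bounded. -/
lemma exists_abs_le_of_forall_ne_two_pi {f : ℝ → ℝ} (hf : Continuous f) {T : ℝ}
    (h : ∀ t, T ≤ t → ∀ n : ℤ, f t ≠ 2 * π * n) : ∃ C, ∀ t, T ≤ t → |f t| ≤ C := by
  have hp := pi_pos
  set n : ℤ := ⌊f T / (2 * π)⌋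
  have h1 : 2 * π * n ≤ f T := by
    have := Int.floor_le (f T / (2 * π))
    rw [le_div_iff₀ (by positivity)] at this
    linarith
  have h2 : f T ≤ 2 * π * (n + 1 : ℤ) := by
    have := Int.lt_floor_add_one (f T / (2 * π))
    rw [div_lt_iff₀ (by positivity)] at this
    push_cast
    linarith
  refine ⟨|2 * π * n| + 2 * π, fun t ht => ?_⟩
  have h3 : 2 * π * n ≤ f t := by
    by_contra! hlt
    obtain ⟨s, hs, hs'⟩ := intermediate_value_Icc' ht hf.continuousOn ⟨hlt.le, h1⟩
    exact h s hs.1 n hs'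
  have h4 : f t ≤ 2 * π * (n + 1 : ℤ) := by
    by_contra! hlt
    obtain ⟨s, hs, hs'⟩ := intermediate_value_Icc ht hf.continuousOn ⟨h2, hlt.le⟩
    exact h s hs.1 (n + 1) hs'
  push_cast at h4
  rw [abs_le]
  constructor <;> cases abs_cases (2 * π * n) <;> linarith

/-- A Barbalat-type lemma: if `E' = -G ≤ 0` on a half-line, `E` is bounded below and `G` has
bounded derivative, then `G` tends to zero. -/
lemma tendsto_zero_of_dissipation {E G G' : ℝ → ℝ} {T B L : ℝ}
    (hE : ∀ t, T ≤ t → HasDerivAt E (-G t) t) (hG : ∀ t, T ≤ t → HasDerivAt G (G' t) t)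
    (hG0 : ∀ t, 0 ≤ G t) (hB : ∀ t, T ≤ t → B ≤ E t) (hL : ∀ t, T ≤ t → |G' t| ≤ L) :
    Tendsto G atTop (nhds 0) := by
  have hL0 : 0 ≤ L := (abs_nonneg _).trans (hL T le_rfl)
  have hanti : AntitoneOn E (Set.Ici T) := by
    refine antitoneOn_of_deriv_nonpos (convex_Ici T)
      (fun t ht => (hE t ht).continuousAt.continuousWithinAt)
      (fun t ht => (hE t (interior_subset ht)).differentiableAt.differentiableWithinAt)
      fun t ht => ?_
    rw [(hE t (interior_subset ht)).deriv]
    exact neg_nonpos.2 (hG0 t)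
  have hdrop : ∀ t, T ≤ t → ∀ h, 0 < h → h * (G t - L * h) ≤ E t - E (t + h) := by
    intro t ht h hh
    have hlip : ∀ s ∈ Set.Icc t (t + h), G t - L * h ≤ G s := by
      intro s hs
      have := (convex_Icc t (t + h)).norm_image_sub_le_of_norm_hasDerivWithin_le
        (fun x hx => (hG x (ht.trans hx.1)).hasDerivWithinAt)
        (fun x hx => hL x (ht.trans hx.1)) (Set.left_mem_Icc.2 (by linarith)) hs
      rw [norm_eq_abs, norm_eq_abs, abs_of_nonneg (sub_nonneg.2 hs.1)] at this
      have h1 := (abs_le.1 this).1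
      have h2 := mul_le_mul_of_nonneg_left (show s - t ≤ h by linarith [hs.2]) hL0
      linarith
    obtain ⟨s, hs, hs'⟩ := exists_hasDerivAt_eq_slope E (fun t => -G t) (show t < t + h by linarith)
      (fun x hx => (hE x (ht.trans hx.1)).continuousAt.continuousWithinAt)
      (fun x hx => hE x (ht.trans hx.1.le))
    rw [eq_div_iff (by linarith)] at hs'
    nlinarith [hlip s (Set.Ioo_subset_Icc_self hs)]
  obtain ⟨l, hl⟩ : ∃ l, Tendsto E atTop (nhds l) := by
    have hmono : Antitone fun t => E (max t T) := fun x y hxy =>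
      hanti (Set.mem_Ici.2 (le_max_right _ _)) (Set.mem_Ici.2 (le_max_right _ _)) (max_le_max_right T hxy)
    refine ⟨_, (tendsto_atTop_ciInf hmono ⟨B, ?_⟩).congr' ?_⟩
    · rintro _ ⟨t, rfl⟩
      exact hB _ (le_max_right _ _)
    · filter_upwards [eventually_ge_atTop T] with t ht
      rw [max_eq_left ht]
  refine tendsto_order.2 ⟨fun x hx => Eventually.of_forall fun t => hx.trans_le (hG0 t),
    fun x hx => ?_⟩
  set h := x / (2 * (L + 1)) with hh
  have hpos : 0 < h := by positivity
  have hLh : L * h < x / 2 := by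
    have : (L + 1) * h = x / 2 := by rw [hh]; field_simp
    linarith
  have hdiff : Tendsto (fun t => E t - E (t + h)) atTop (nhds 0) := by
    simpa using hl.sub (hl.comp (tendsto_atTop_add_const_right _ h tendsto_id))
  filter_upwards [eventually_ge_atTop T,
    hdiff.eventually_lt_const (show 0 < h * (x / 2) by positivity)] with t ht ht'
  have := lt_of_mul_lt_mul_left ((hdrop t ht h hpos).trans_lt ht') hpos.le
  linarith

/-- `θ` solves the second-order Kuramoto system on `[0, ∞)`, with velocities `v` and
accelerations `a`. -/
structure IsKuramotoSolution {N : ℕ} (m K : ℝ) (ω : Fin N → ℝ) (θ v a : Fin N → ℝ → ℝ) :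
    Prop where
  phase : ∀ i t, HasDerivAt (θ i) (v i t) t
  velocity : ∀ i t, HasDerivAt (v i) (a i t) t
  ode : ∀ i t, 0 ≤ t → m * a i t + v i t = ω i + K / N * ∑ j, sin (θ j t - θ i t)

namespace IsKuramotoSolution

variable {N : ℕ} {m K : ℝ} {ω : Fin N → ℝ} {θ v a : Fin N → ℝ → ℝ}

/-- Shifting phases by multiples of `2π` preserves solutions. -/
lemma sub_two_pi_mul (h : IsKuramotoSolution m K ω θ v a) (n : Fin N → ℤ) :
    IsKuramotoSolution m K ω (fun i t => θ i t - n i * (2 * π)) v a where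
  phase i t := (h.phase i t).sub_const _
  velocity := h.velocity
  ode i t ht := by
    rw [h.ode i t ht]
    congr 2
    refine Finset.sum_congr rfl fun j _ => ?_
    rw [show θ j t - n j * (2 * π) - (θ i t - n i * (2 * π))
      = θ j t - θ i t + ((n i - n j : ℤ) : ℝ) * (2 * π) by push_cast; ring,
      sin_add_int_mul_two_pi]

lemma phase_sub (h : IsKuramotoSolution m K ω θ v a) (i j : Fin N) (t : ℝ) :
    HasDerivAt (fun t => θ i t - θ j t) (v i t - v j t) t :=
  (h.phase i t).sub (h.phase j t)

lemma velocity_sub (h : IsKuramotoSolution m K ω θ v a) (i j : Fin N) (t : ℝ) :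
    HasDerivAt (fun t => v i t - v j t) (a i t - a j t) t :=
  (h.velocity i t).sub (h.velocity j t)

lemma ode_sub (h : IsKuramotoSolution m K ω θ v a) (i j : Fin N) {t : ℝ} (ht : 0 ≤ t) :
    m * (a i t - a j t) + (v i t - v j t) = ω i - ω j - 2 * (K / N *
      ∑ k, sin ((θ i t - θ j t) / 2) * cos (θ k t - (θ i t + θ j t) / 2)) := by
  have h1 : ∀ k, sin (θ k t - θ i t) = sin (θ k t - θ j t)
      - 2 * (sin ((θ i t - θ j t) / 2) * cos (θ k t - (θ i t + θ j t) / 2)) := by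
    intro k
    have := sin_sub_sin (θ k t - θ j t) (θ k t - θ i t)
    rw [show (θ k t - θ j t - (θ k t - θ i t)) / 2 = (θ i t - θ j t) / 2 by ring,
      show (θ k t - θ j t + (θ k t - θ i t)) / 2 = θ k t - (θ i t + θ j t) / 2 by ring] at this
    linarith
  have h2 := h.ode i t ht
  have h3 := h.ode j t ht
  simp only [h1, Finset.sum_sub_distrib, ← Finset.mul_sum] at h2
  rw [← Finset.mul_sum]
  linear_combination h2 - h3

lemma drift_le (h : IsKuramotoSolution m K ω θ v a) (hK : 0 ≤ K) (hN : 0 < N) (i j : Fin N)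
    {t : ℝ} (ht : 0 ≤ t) :
    m * (a i t - a j t) + (v i t - v j t) ≤ ω i - ω j + 2 * K := by
  have hN' : (0 : ℝ) < N := by exact_mod_cast hN
  rw [h.ode_sub i j ht]
  have h1 : ∑ k : Fin N, (-1 : ℝ)
      ≤ ∑ k, sin ((θ i t - θ j t) / 2) * cos (θ k t - (θ i t + θ j t) / 2) := by
    refine Finset.sum_le_sum fun k _ => ?_
    refine (abs_le.1 ?_).1
    rw [abs_mul]
    exact mul_le_one₀ (abs_sin_le_one _) (abs_nonneg _) (abs_cos_le_one _)
  have h2 := mul_le_mul_of_nonneg_left h1 (show 0 ≤ K / N by positivity)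
  have h3 : K / N * ∑ k : Fin N, (-1 : ℝ) = -K := by
    simp; field_simp
  linarith

/-- A nearly antipodal pair of a large cluster is pulled together. -/
lemma drift_le_of_cluster (h : IsKuramotoSolution m K ω θ v a) (hK : 0 ≤ K) (hN : 0 < N)
    {α β μ : ℝ} (hβ : 0 < β) (hβα : β < α) (hαβπ : 2 * β + α < π) {S : Finset (Fin N)}
    (hS : μ ≤ (S.card : ℝ) / N * sin (α / 2 - β / 4) * cos (α / 2 + 5 / 8 * β)
        - (1 - (S.card : ℝ) / N) * cos (α / 2 - β / 8))
    (i j : Fin N) (hω : ω i - ω j ≤ μ * K) {t : ℝ} (ht : 0 ≤ t)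
    (hlow : π - α - 5 / 4 * β ≤ θ i t - θ j t) (hup : θ i t - θ j t ≤ π - α + β / 4)
    (hmid : ∀ k ∈ S, |θ k t - (θ i t + θ j t) / 2| ≤ π / 2 - α / 2 + β / 4) :
    m * (a i t - a j t) + (v i t - v j t) ≤ -(μ * K) := by
  have hN' : (0 : ℝ) < N := by exact_mod_cast hN
  rw [h.ode_sub i j ht]
  have hc0 : 0 ≤ cos (α / 2 + 5 / 8 * β) :=
    cos_nonneg_of_neg_pi_div_two_le_of_le (by linarith) (by linarith)
  have hs0 : 0 ≤ sin (α / 2 - β / 4) :=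
    sin_nonneg_of_nonneg_of_le_pi (by linarith) (by linarith)
  have hs1 : cos (α / 2 + 5 / 8 * β) ≤ sin ((θ i t - θ j t) / 2) := by
    rw [← sin_pi_div_two_sub]
    exact sin_le_sin_of_le_of_le_pi_div_two (by linarith) (by linarith) (by linarith)
  have hs2 : sin ((θ i t - θ j t) / 2) ≤ cos (α / 2 - β / 8) := by
    rw [← sin_pi_div_two_sub]
    exact sin_le_sin_of_le_of_le_pi_div_two (by linarith) (by linarith) (by linarith)
  have hin : ∀ k ∈ S, sin (α / 2 - β / 4) * cos (α / 2 + 5 / 8 * β)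
      ≤ sin ((θ i t - θ j t) / 2) * cos (θ k t - (θ i t + θ j t) / 2) := by
    intro k hk
    have : sin (α / 2 - β / 4) ≤ cos (θ k t - (θ i t + θ j t) / 2) := by
      rw [← cos_abs (θ k t - (θ i t + θ j t) / 2), ← cos_pi_div_two_sub]
      exact cos_le_cos_of_nonneg_of_le_pi (abs_nonneg _) (by linarith)
        (by linarith [hmid k hk])
    rw [mul_comm]
    exact mul_le_mul hs1 this hs0 (hc0.trans hs1)
  have hout : ∀ k, -cos (α / 2 - β / 8)
      ≤ sin ((θ i t - θ j t) / 2) * cos (θ k t - (θ i t + θ j t) / 2) := by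
    intro k
    nlinarith [neg_one_le_cos (θ k t - (θ i t + θ j t) / 2)]
  have hsum : (S.card : ℝ) * (sin (α / 2 - β / 4) * cos (α / 2 + 5 / 8 * β))
      + (N - S.card) * -cos (α / 2 - β / 8)
      ≤ ∑ k, sin ((θ i t - θ j t) / 2) * cos (θ k t - (θ i t + θ j t) / 2) := by
    rw [← Finset.sum_add_sum_compl S]
    have hcard : ((Sᶜ.card : ℕ) : ℝ) = N - S.card := by
      rw [Finset.card_compl, Fintype.card_fin, Nat.cast_sub]
      simpa using S.card_le_univ
    refine add_le_add ?_ ?_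
    · simpa [nsmul_eq_mul] using S.card_nsmul_le_sum _ _ hin
    · rw [← hcard, ← nsmul_eq_mul]
      exact Finset.card_nsmul_le_sum _ _ _ fun k _ => hout k
  have h2 := mul_le_mul_of_nonneg_left hsum (show 0 ≤ K / N by positivity)
  have h3 := mul_le_mul_of_nonneg_right hS hK
  have h4 : K / N * ((S.card : ℝ) * (sin (α / 2 - β / 4) * cos (α / 2 + 5 / 8 * β))
      + (N - S.card) * -cos (α / 2 - β / 8))
      = ((S.card : ℝ) / N * sin (α / 2 - β / 4) * cos (α / 2 + 5 / 8 * β)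
        - (1 - (S.card : ℝ) / N) * cos (α / 2 - β / 8)) * K := by
    field_simp; ring
  linarith

/-- Velocity differences bounded by `lam * K` stay so. -/
lemma velocity_sub_lt (h : IsKuramotoSolution m K ω θ v a) (hm : 0 < m) (hK : 0 < K) (hN : 0 < N)
    {μ lam : ℝ} (hlam : μ + 2 < lam) (i j : Fin N) (hω : ω i - ω j ≤ μ * K) {t₀ t : ℝ}
    (ht₀ : 0 ≤ t₀) (ht : t₀ ≤ t) (hv : v i t₀ - v j t₀ < lam * K) :
    v i t - v j t < lam * K := by
  have h1 := le_add_mul_exp_of_relaxation (C := (μ + 2) * K) hm ht (h.velocity_sub i j)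
    fun s hs => by linarith [h.drift_le hK.le hN i j (ht₀.trans hs.1)]
  have h2 : exp (-((t - t₀) / m)) ≤ 1 :=
    exp_le_one_iff.2 (neg_nonpos.2 (div_nonneg (sub_nonneg.2 ht) hm.le))
  have h3 := exp_pos (-((t - t₀) / m))
  have h4 : (μ + 2) * K < lam * K := mul_lt_mul_of_pos_right hlam hK
  nlinarith [mul_lt_mul_of_pos_right hv h3]

/-- All velocity differences eventually drop below `lam * K`. -/
lemma eventually_velocity_sub_lt (h : IsKuramotoSolution m K ω θ v a) (hm : 0 < m) (hK : 0 < K)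
    (hN : 0 < N) {μ lam : ℝ} (hlam : μ + 2 < lam) (hω : ∀ i j, ω i - ω j ≤ μ * K) :
    ∀ᶠ t in atTop, ∀ i j, v i t - v j t < lam * K := by
  refine eventually_all.2 fun i => eventually_all.2 fun j => ?_
  have hexp : Tendsto (fun t => (μ + 2) * K + (v i 0 - v j 0 - (μ + 2) * K) * exp (-((t - 0) / m)))
      atTop (nhds ((μ + 2) * K + (v i 0 - v j 0 - (μ + 2) * K) * 0)) := by
    refine ((tendsto_exp_neg_atTop_nhds_zero.comp ?_).const_mul _).const_add _
    simpa using tendsto_id.atTop_div_const hm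
  have h4 : (μ + 2) * K + (v i 0 - v j 0 - (μ + 2) * K) * 0 < lam * K := by
    rw [mul_zero, add_zero]
    exact mul_lt_mul_of_pos_right hlam hK
  filter_upwards [hexp.eventually_lt_const h4, eventually_ge_atTop 0] with t ht ht0
  refine (le_add_mul_exp_of_relaxation (C := (μ + 2) * K) hm ht0 (h.velocity_sub i j)
    fun s hs => ?_).trans_lt ht
  linarith [h.drift_le hK.le hN i j hs.1, hω i j]

lemma phase_sub_le_add (h : IsKuramotoSolution m K ω θ v a) (i j : Fin N) {C s t : ℝ}
    (hst : s ≤ t) (hv : ∀ x ∈ Set.Icc s t, v i x - v j x ≤ C) :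
    θ i t - θ j t ≤ θ i s - θ j s + C * (t - s) := by
  have := (convex_Icc s t).image_sub_le_mul_sub_of_deriv_le
    (fun x _ => (h.phase_sub i j x).continuousAt.continuousWithinAt)
    (fun x _ => (h.phase_sub i j x).differentiableAt.differentiableWithinAt)
    (fun x hx => by rw [(h.phase_sub i j x).deriv]; exact hv x (interior_subset hx))
    s (Set.left_mem_Icc.2 hst) t (Set.right_mem_Icc.2 hst) hst
  linarith

/-- After a relaxation time `τ`, a maximal pair of a cluster of nearly critical width
is contracting at a definite rate. -/
lemma velocity_sub_le_of_maximal (h : IsKuramotoSolution m K ω θ v a) (hm : 0 < m) (hK : 0 < K)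
    (hN : 0 < N) {α β μ lam τ t₀ : ℝ} (hβ : 0 < β) (hβα : β < α) (hαβπ : 2 * β + α < π)
    (hμ0 : 0 < μ) (hlam : μ + 2 < lam) (hτ0 : 0 ≤ τ)
    (hexp : exp (-(τ / m)) = μ / (lam + 2 * μ + 2)) (hτ : lam * K * τ ≤ β / 4)
    {S : Finset (Fin N)}
    (hS : μ ≤ (S.card : ℝ) / N * sin (α / 2 - β / 4) * cos (α / 2 + 5 / 8 * β)
        - (1 - (S.card : ℝ) / N) * cos (α / 2 - β / 8))
    (hω : ∀ i j, ω i - ω j ≤ μ * K) (ht₀ : 0 ≤ t₀)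
    (hv : ∀ t, t₀ ≤ t → ∀ i ∈ S, ∀ j ∈ S, v i t - v j t < lam * K)
    {t y : ℝ} (ht : t₀ + τ ≤ t) (hy₀ : π - α - β ≤ y) (hy₁ : y ≤ π - α - 3 / 4 * β)
    (hy : ∀ k ∈ S, ∀ l ∈ S, θ k t - θ l t ≤ y) {i j : Fin N} (hi : i ∈ S) (hj : j ∈ S)
    (hij : θ i t - θ j t = y) :
    v i t - v j t ≤ -(μ * K * ((μ + 2) / (lam + 2 * μ + 2))) := by
  have hdisp : ∀ s ∈ Set.Icc (t - τ) t, ∀ k ∈ S, ∀ l ∈ S,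
      θ k t - θ l t ≤ θ k s - θ l s + β / 4 := by
    intro s hs k hk l hl
    have h1 := h.phase_sub_le_add k l hs.2
      fun x hx => (hv x (by linarith [hs.1, hx.1]) k hk l hl).le
    have h2 : lam * K * (t - s) ≤ lam * K * τ :=
      mul_le_mul_of_nonneg_left (by linarith [hs.1]) (mul_nonneg (by linarith) hK.le)
    linarith
  have h1 := le_add_mul_exp_of_relaxation (C := -(μ * K)) hm (show t - τ ≤ t by linarith)
    (h.velocity_sub i j) fun s hs => by
      have hlow := hdisp s hs i hi j hj
      have hw : ∀ k ∈ S, ∀ l ∈ S, θ k s - θ l s ≤ y + β / 4 := fun k hk l hl => by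
        linarith [hdisp s hs l hl k hk, hy k hk l hl, hdisp s hs k hk l hl,
          hy l hl k hk, h.phase_sub_le_add l k hs.2
            fun x hx => (hv x (by linarith [hs.1, hx.1]) l hl k hk).le]
      refine h.drift_le_of_cluster hK.le hN hβ hβα hαβπ hS i j (hω i j)
        (by linarith [hs.1]) (by linarith) (by linarith [hw i hi j hj]) fun k hk => ?_
      rw [abs_le]
      constructor <;> linarith [hw k hk j hj, hw i hi k hk]
  rw [show t - (t - τ) = τ by ring, hexp] at h1
  have hd : 0 < lam + 2 * μ + 2 := by linarith
  have h2 := mul_le_mul_of_nonneg_right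
    (hv (t - τ) (by linarith) i hi j hj).le (div_pos hμ0 hd).le
  have h3 : -(μ * K) + (lam * K + μ * K) * (μ / (lam + 2 * μ + 2))
      = -(μ * K * ((μ + 2) / (lam + 2 * μ + 2))) := by
    linear_combination (μ * K) * mul_inv_cancel₀ hd.ne'
  linarith

/-- A large cluster of subcritical width eventually stays of subcritical width. -/
lemma exists_forall_phase_sub_le (h : IsKuramotoSolution m K ω θ v a) (hm : 0 < m) (hK : 0 < K)
    (hN : 0 < N) {α β μ lam τ t₀ : ℝ} (hβ : 0 < β) (hβα : β < α) (hαβπ : 2 * β + α < π)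
    (hμ0 : 0 < μ) (hlam : μ + 2 < lam) (hτ0 : 0 ≤ τ)
    (hexp : exp (-(τ / m)) = μ / (lam + 2 * μ + 2)) (hτ : lam * K * τ ≤ β / 4)
    {S : Finset (Fin N)}
    (hS : μ ≤ (S.card : ℝ) / N * sin (α / 2 - β / 4) * cos (α / 2 + 5 / 8 * β)
        - (1 - (S.card : ℝ) / N) * cos (α / 2 - β / 8))
    (hω : ∀ i j, ω i - ω j ≤ μ * K) (ht₀ : 0 ≤ t₀)
    (hθ : ∀ i ∈ S, ∀ j ∈ S, θ i t₀ - θ j t₀ ≤ π - α - β)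
    (hv : ∀ i ∈ S, ∀ j ∈ S, v i t₀ - v j t₀ < lam * K) :
    ∃ T, t₀ ≤ T ∧ ∀ t, T ≤ t → ∀ i ∈ S, ∀ j ∈ S, θ i t - θ j t ≤ π - α - β := by
  have hv' : ∀ t, t₀ ≤ t → ∀ i ∈ S, ∀ j ∈ S, v i t - v j t < lam * K := fun t ht i hi j hj =>
    h.velocity_sub_lt hm hK hN hlam i j (hω i j) ht₀ ht (hv i hi j hj)
  set δ : ℝ := μ * K * ((μ + 2) / (lam + 2 * μ + 2)) with hδ
  have hd : 0 < lam + 2 * μ + 2 := by linarith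
  have hδ0 : 0 < δ := by positivity
  set ε := δ / 2 with hε
  have hε0 : 0 < ε := by positivity
  set b := t₀ + τ + β / 4 / ε with hb
  have hbε : ε * (b - (t₀ + τ)) = β / 4 := by rw [hb]; field_simp; ring
  have hbt : t₀ + τ ≤ b := by rw [hb]; linarith [show 0 < β / 4 / ε by positivity]
  have hpair : ∀ (k : S × S) t,
      HasDerivAt (fun t => θ k.1 t - θ k.2 t) (v k.1 t - v k.2 t) t :=
    fun k t => h.phase_sub _ _ t
  have hb1 : ∀ k : S × S, θ k.1 b - θ k.2 b ≤ π - α - β := by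
    have := forall_le_line_of_deriv_lt (a := t₀ + τ) (b := b) (c := π - α - 3 / 4 * β) (ε := ε)
      hpair (fun k => ?_) (fun t ht hall k hk => ?_) b (Set.right_mem_Icc.2 hbt)
    · intro k
      have := this k
      rw [hbε] at this
      linarith
    · have h1 := h.phase_sub_le_add k.1 k.2 (show t₀ ≤ t₀ + τ by linarith)
        fun x hx => (hv' x hx.1 _ k.1.2 _ k.2.2).le
      rw [add_sub_cancel_left] at h1
      linarith [hθ _ k.1.2 _ k.2.2]
    · have hεt : ε * (t - (t₀ + τ)) ≤ ε * (b - (t₀ + τ)) :=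
        mul_le_mul_of_nonneg_left (by linarith [ht.2]) hε0.le
      have hεt' : 0 ≤ ε * (t - (t₀ + τ)) := mul_nonneg hε0.le (by linarith [ht.1])
      have := h.velocity_sub_le_of_maximal hm hK hN hβ hβα hαβπ hμ0 hlam hτ0 hexp hτ hS hω ht₀
        hv' ht.1 (y := π - α - 3 / 4 * β - ε * (t - (t₀ + τ))) (by linarith) (by linarith)
        (fun k hk l hl => hall (⟨k, hk⟩, ⟨l, hl⟩)) k.1.2 k.2.2 hk
      linarith
  refine ⟨b, by linarith, fun t ht i hi j hj => ?_⟩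
  have := forall_le_line_of_deriv_lt (a := b) (b := t) (c := π - α - β) (ε := 0)
    hpair hb1 (fun s hs hall k hk => ?_) t (Set.right_mem_Icc.2 ht) (⟨i, hi⟩, ⟨j, hj⟩)
  · simpa using this
  · simp only [zero_mul, sub_zero] at hall hk
    have := h.velocity_sub_le_of_maximal hm hK hN hβ hβα hαβπ hμ0 hlam hτ0 hexp hτ hS hω ht₀
      hv' (hbt.trans hs.1) le_rfl (by linarith)
      (fun k hk l hl => hall (⟨k, hk⟩, ⟨l, hl⟩)) k.1.2 k.2.2 hk
    linarith

/-- If a large cluster has subcritical width, then all phase differences are eventually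
bounded: every oscillator either never meets the cluster modulo `2π`, or joins it. -/
lemma exists_forall_abs_phase_sub_le (hm : 0 < m) (hK : 0 < K)
    (hN : 0 < N) {α β μ lam τ : ℝ} (hβ : 0 < β) (hβα : β < α) (hαβπ : 2 * β + α < π)
    (hμ0 : 0 < μ) (hlam : μ + 2 < lam) (hτ0 : 0 ≤ τ)
    (hexp : exp (-(τ / m)) = μ / (lam + 2 * μ + 2)) (hτ : lam * K * τ ≤ β / 4)
    (hω : ∀ i j, ω i - ω j ≤ μ * K) (n : ℕ) :
    ∀ {θ : Fin N → ℝ → ℝ} (_ : IsKuramotoSolution m K ω θ v a) {S : Finset (Fin N)}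
    (_ : Sᶜ.card = n) (_ : S.Nonempty)
    (_ : μ ≤ (S.card : ℝ) / N * sin (α / 2 - β / 4) * cos (α / 2 + 5 / 8 * β)
        - (1 - (S.card : ℝ) / N) * cos (α / 2 - β / 8)) {t₀ : ℝ} (_ : 0 ≤ t₀)
    (_ : ∀ i ∈ S, ∀ j ∈ S, θ i t₀ - θ j t₀ ≤ π - α - β)
    (_ : ∀ i ∈ S, ∀ j ∈ S, v i t₀ - v j t₀ < lam * K),
    ∃ C T, 0 ≤ T ∧ ∀ t, T ≤ t → ∀ i j, |θ i t - θ j t| ≤ C := by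
  induction n with
  | zero =>
    intro θ h S hcard _ hS t₀ ht₀ hθ hv
    obtain ⟨T, hT, hb⟩ := h.exists_forall_phase_sub_le hm hK hN hβ hβα hαβπ hμ0 hlam hτ0 hexp hτ
      hS hω ht₀ hθ hv
    have hmem : ∀ i, i ∈ S := fun i => by
      by_contra hi
      simpa [Finset.card_eq_zero.1 hcard] using Finset.mem_compl.2 hi
    refine ⟨π - α - β, T, ht₀.trans hT, fun t ht i j => abs_le.2 ⟨?_, ?_⟩⟩
    · linarith [hb t ht j (hmem j) i (hmem i)]
    · exact hb t ht i (hmem i) j (hmem j)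
  | succ n ih =>
    intro θ h S hcard ⟨s, hs⟩ hS t₀ ht₀ hθ hv
    obtain ⟨T₁, hT₁, hb⟩ := h.exists_forall_phase_sub_le hm hK hN hβ hβα hαβπ hμ0 hlam hτ0 hexp
      hτ hS hω ht₀ hθ hv
    obtain ⟨T₂, hT₂⟩ := eventually_atTop.1 (h.eventually_velocity_sub_lt hm hK hN hlam hω)
    set T := max T₁ T₂
    have hT0 : 0 ≤ T := (ht₀.trans hT₁).trans (le_max_left _ _)
    by_cases hmeet : ∃ i, i ∉ S ∧ ∃ t, T ≤ t ∧ ∃ k : ℤ, θ i t - θ s t = 2 * π * k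
    · obtain ⟨i, hi, t, ht, k, hk⟩ := hmeet
      set p : Fin N → ℤ := fun j => if j = i then k else 0 with hp
      have hpi : p i = k := if_pos rfl
      have hpS : ∀ j ∈ S, p j = 0 := fun j hj => if_neg fun hji : j = i => hi (hji ▸ hj)
      have hpos : ∀ j ∈ insert i S, ∃ l ∈ S, θ j t - p j * (2 * π) = θ l t := by
        intro j hj
        rcases Finset.mem_insert.1 hj with rfl | hj
        · exact ⟨s, hs, by rw [hpi]; linarith⟩
        · exact ⟨j, hj, by simp [hpS j hj]⟩
      have hcard' : (insert i S)ᶜ.card = n := by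
        have h1 := Finset.card_insert_of_notMem hi
        have h2 := Finset.card_compl_add_card (insert i S)
        have h3 := Finset.card_compl_add_card S
        omega
      have hN' : (0 : ℝ) < N := by exact_mod_cast hN
      have hS' : μ ≤ ((insert i S).card : ℝ) / N * sin (α / 2 - β / 4) * cos (α / 2 + 5 / 8 * β)
          - (1 - ((insert i S).card : ℝ) / N) * cos (α / 2 - β / 8) := by
        rw [Finset.card_insert_of_notMem hi]
        have hc0 : 0 ≤ cos (α / 2 + 5 / 8 * β) :=
          cos_nonneg_of_neg_pi_div_two_le_of_le (by linarith) (by linarith)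
        have hs0 : 0 ≤ sin (α / 2 - β / 4) :=
          sin_nonneg_of_nonneg_of_le_pi (by linarith) (by linarith)
        have hc1 : 0 ≤ cos (α / 2 - β / 8) :=
          cos_nonneg_of_neg_pi_div_two_le_of_le (by linarith) (by linarith)
        have h1 : ((S.card + 1 : ℕ) : ℝ) / N = S.card / N + 1 / N := by push_cast; ring
        have h2 : 0 ≤ 1 / (N : ℝ) * sin (α / 2 - β / 4) * cos (α / 2 + 5 / 8 * β) := by positivity
        have h3 : 0 ≤ 1 / (N : ℝ) * cos (α / 2 - β / 8) := by positivity
        rw [h1]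
        linarith
      obtain ⟨C, T', hT', hC⟩ := ih (h.sub_two_pi_mul p) hcard' (Finset.insert_nonempty i S) hS'
        (hT0.trans ht) (fun j hj l hl => by
          obtain ⟨j', hj', hj''⟩ := hpos j hj
          obtain ⟨l', hl', hl''⟩ := hpos l hl
          rw [hj'', hl'']
          exact hb t ((le_max_left _ _).trans ht) j' hj' l' hl')
        fun j _ l _ => hT₂ t ((le_max_right _ _).trans ht) j l
      refine ⟨C + |2 * π * k|, T', hT', fun t ht j l => ?_⟩
      have h1 := hC t ht j l
      have h2 : ∀ j, p j = k ∨ p j = 0 := fun j => by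
        simp only [hp]; split_ifs <;> simp
      rw [abs_le] at h1 ⊢
      rcases h2 j with hj | hj <;> rcases h2 l with hl | hl <;> rw [hj, hl] at h1 <;>
        push_cast at h1 <;>
        constructor <;> linarith [neg_abs_le (2 * π * k), le_abs_self (2 * π * k)]
    · push Not at hmeet
      have hbdd : ∀ i, ∃ C, ∀ t, T ≤ t → |θ i t - θ s t| ≤ C := by
        intro i
        by_cases hi : i ∈ S
        · refine ⟨π - α - β, fun t ht => abs_le.2 ⟨?_, ?_⟩⟩
          · linarith [hb t ((le_max_left _ _).trans ht) s hs i hi]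
          · exact hb t ((le_max_left _ _).trans ht) i hi s hs
        · exact exists_abs_le_of_forall_ne_two_pi
            (continuous_iff_continuousAt.2 fun t => (h.phase_sub i s t).continuousAt) (hmeet i hi)
      choose C hC using hbdd
      have hC0 : ∀ i, 0 ≤ C i := fun i => (abs_nonneg _).trans (hC i T le_rfl)
      refine ⟨2 * ∑ i, C i, T, hT0, fun t ht i j => ?_⟩
      have h1 := Finset.single_le_sum (fun i _ => hC0 i) (Finset.mem_univ i)
      have h2 := Finset.single_le_sum (fun i _ => hC0 i) (Finset.mem_univ j)
      have h3 := abs_le.1 (hC i t ht)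
      have h4 := abs_le.1 (hC j t ht)
      exact abs_le.2 ⟨by linarith, by linarith⟩

/-- Velocities and accelerations stay bounded. -/
lemma exists_abs_velocity_le (h : IsKuramotoSolution m K ω θ v a) (hm : 0 < m) (i : Fin N) :
    ∃ V, ∀ t, 0 ≤ t → |v i t| ≤ V ∧ |a i t| ≤ V := by
  set C := |ω i| + |K / N| * N with hC
  have hrhs : ∀ t, 0 ≤ t → |m * a i t + v i t| ≤ C := by
    intro t ht
    rw [h.ode i t ht, hC]
    refine (abs_add_le _ _).trans (add_le_add le_rfl ?_)
    rw [abs_mul]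
    refine mul_le_mul_of_nonneg_left ((Finset.abs_sum_le_sum_abs _ _).trans ?_) (abs_nonneg _)
    simpa using Finset.sum_le_card_nsmul Finset.univ (fun j => |sin (θ j t - θ i t)|) 1
      fun j _ => abs_sin_le_one _
  have hC0 : 0 ≤ C := (abs_nonneg _).trans (hrhs 0 le_rfl)
  have hexp : ∀ x y : ℝ, 0 ≤ x → (y - C) * exp (-((x - 0) / m)) ≤ |y| := by
    intro x y hx
    have h2 : exp (-((x - 0) / m)) ≤ 1 :=
      exp_le_one_iff.2 (neg_nonpos.2 (div_nonneg (by linarith) hm.le))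
    have h3 := exp_pos (-((x - 0) / m))
    nlinarith [le_abs_self y, abs_nonneg y]
  have hv : ∀ t, 0 ≤ t → |v i t| ≤ C + |v i 0| := by
    intro t ht
    have h1 := le_add_mul_exp_of_relaxation (C := C) hm ht (h.velocity i)
      fun s hs => (abs_le.1 (hrhs s hs.1)).2
    have h2 := le_add_mul_exp_of_relaxation (f := fun t => -v i t) (f' := fun t => -a i t)
      (C := C) hm ht (fun t => (h.velocity i t).neg)
      fun s hs => by linarith [(abs_le.1 (hrhs s hs.1)).1]
    have h3 := hexp t (v i 0) ht
    have h4 := hexp t (-v i 0) ht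
    rw [abs_neg] at h4
    exact abs_le.2 ⟨by linarith, by linarith⟩
  refine ⟨max (C + |v i 0|) ((2 * C + |v i 0|) / m), fun t ht =>
    ⟨(hv t ht).trans (le_max_left _ _), le_trans ?_ (le_max_right _ _)⟩⟩
  rw [le_div_iff₀ hm, show |a i t| * m = |m * a i t| by rw [abs_mul, abs_of_pos hm, mul_comm]]
  have h1 := abs_le.1 (hv t ht)
  have h2 := abs_le.1 (hrhs t ht)
  exact abs_le.2 ⟨by linarith, by linarith⟩

/-- Bounded phase differences force complete frequency synchronization. -/
lemma tendsto_velocity (h : IsKuramotoSolution m K ω θ v a) (hm : 0 < m) (hK : 0 < K) (hN : 0 < N)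
    {C T : ℝ} (hT : 0 ≤ T) (hC : ∀ t, T ≤ t → ∀ i j, |θ i t - θ j t| ≤ C) (i : Fin N) :
    Tendsto (v i) atTop (nhds ((1 / N : ℝ) * ∑ k, ω k)) := by
  have hN' : (0 : ℝ) < N := by exact_mod_cast hN
  set w : ℝ := (1 / N : ℝ) * ∑ k, ω k with hw
  have hsum : ∑ k, (ω k - w) = 0 := by
    simp [Finset.sum_sub_distrib, hw]
    field_simp
    ring
  set E : ℝ → ℝ := fun t => m / 2 * ∑ k, (v k t - w) ^ 2 - ∑ k, (ω k - w) * θ k t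
    - K / (2 * N) * ∑ k, ∑ l, cos (θ l t - θ k t) with hE
  set G : ℝ → ℝ := fun t => ∑ k, (v k t - w) ^ 2 with hG
  set G' : ℝ → ℝ := fun t => ∑ k, 2 * (v k t - w) * a k t with hG'
  have hGderiv : ∀ t, HasDerivAt G (G' t) t := fun t => by
    refine HasDerivAt.fun_sum fun k _ => ?_
    exact (((h.velocity k t).sub_const w).pow 2).congr_deriv (by simp)
  have hanti : ∀ t, ∑ k, ∑ l, sin (θ l t - θ k t) * (v l t - v k t)
      = -2 * ∑ k, ∑ l, sin (θ l t - θ k t) * (v k t - w) := by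
    intro t
    have h1 : ∑ k, ∑ l, sin (θ l t - θ k t) * (v l t - w)
        = -∑ k, ∑ l, sin (θ l t - θ k t) * (v k t - w) := by
      rw [Finset.sum_comm, ← Finset.sum_neg_distrib]
      refine Finset.sum_congr rfl fun k _ => ?_
      rw [← Finset.sum_neg_distrib]
      refine Finset.sum_congr rfl fun l _ => ?_
      rw [← neg_sub, sin_neg]
      ring
    have h2 : ∀ k l, sin (θ l t - θ k t) * (v l t - v k t)
        = sin (θ l t - θ k t) * (v l t - w) - sin (θ l t - θ k t) * (v k t - w) := by
      intros; ring
    simp only [h2, Finset.sum_sub_distrib, h1]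
    ring
  have hEderiv : ∀ t, T ≤ t → HasDerivAt E (-G t) t := by
    intro t ht
    have hcos : HasDerivAt (fun t => ∑ k, ∑ l, cos (θ l t - θ k t))
        (∑ k, ∑ l, -sin (θ l t - θ k t) * (v l t - v k t)) t :=
      HasDerivAt.fun_sum fun k _ => HasDerivAt.fun_sum fun l _ => (h.phase_sub l k t).cos
    have hlin : HasDerivAt (fun t => ∑ k, (ω k - w) * θ k t) (∑ k, (ω k - w) * v k t) t :=
      HasDerivAt.fun_sum fun k _ => (h.phase k t).const_mul _
    refine ((((hGderiv t).const_mul (m / 2)).sub hlin).sub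
      (hcos.const_mul (K / (2 * N)))).congr_deriv ?_
    have hode : ∀ k, (v k t - w) * (m * a k t) = (v k t - w) * (ω k - w)
        + K / N * ∑ l, sin (θ l t - θ k t) * (v k t - w) - (v k t - w) ^ 2 := by
      intro k
      rw [← Finset.sum_mul]
      linear_combination (v k t - w) * h.ode k t (hT.trans ht)
    have h1 := Finset.sum_congr (rfl : Finset.univ = Finset.univ) fun k _ => hode k
    rw [Finset.sum_sub_distrib, Finset.sum_add_distrib, ← Finset.mul_sum] at h1
    have h2 : ∑ k, (ω k - w) * v k t = ∑ k, (v k t - w) * (ω k - w) := by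
      rw [← sub_eq_zero, ← Finset.sum_sub_distrib]
      calc _ = w * ∑ k, (ω k - w) := by
            rw [Finset.mul_sum]; exact Finset.sum_congr rfl fun k _ => by ring
        _ = 0 := by rw [hsum, mul_zero]
    have h3 : m / 2 * G' t = ∑ k, (v k t - w) * (m * a k t) := by
      rw [hG', Finset.mul_sum]; exact Finset.sum_congr rfl fun k _ => by ring
    simp only [neg_mul, Finset.sum_neg_distrib, hanti t]
    rw [h3, h1, h2, hG]
    field_simp
    ring
  have hbelow : ∀ t, T ≤ t → -(∑ k, |ω k - w| * C) - K / (2 * N) * (N * N) ≤ E t := by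
    intro t ht
    have h1 : 0 ≤ m / 2 * ∑ k, (v k t - w) ^ 2 := by positivity
    have h2 : ∑ k, (ω k - w) * θ k t ≤ ∑ k, |ω k - w| * C := by
      have : ∑ k, (ω k - w) * θ k t = ∑ k, (ω k - w) * (θ k t - θ i t) := by
        simp only [mul_sub, Finset.sum_sub_distrib, ← Finset.sum_mul, hsum]
        ring
      rw [this]
      refine Finset.sum_le_sum fun k _ => (le_abs_self _).trans ?_
      rw [abs_mul]
      exact mul_le_mul_of_nonneg_left (hC t ht k i) (abs_nonneg _)
    have h3 : ∑ k, ∑ l, cos (θ l t - θ k t) ≤ N * N := by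
      calc _ ≤ ∑ _k : Fin N, ∑ _l : Fin N, (1 : ℝ) :=
            Finset.sum_le_sum fun k _ => Finset.sum_le_sum fun l _ => cos_le_one _
        _ = N * N := by simp
    have h4 := mul_le_mul_of_nonneg_left h3 (show 0 ≤ K / (2 * N) by positivity)
    simp only [hE]
    linarith
  choose V hV using h.exists_abs_velocity_le hm
  have hG'bound : ∀ t, T ≤ t → |G' t| ≤ ∑ k, 2 * (V k + |w|) * V k := by
    intro t ht
    refine (Finset.abs_sum_le_sum_abs _ _).trans (Finset.sum_le_sum fun k _ => ?_)
    obtain ⟨h1, h2⟩ := hV k t (hT.trans ht)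
    rw [abs_mul, abs_mul, abs_two]
    have h3 : |v k t - w| ≤ V k + |w| := (abs_sub _ _).trans (add_le_add h1 le_rfl)
    exact mul_le_mul (by linarith) h2 (abs_nonneg _) (by linarith [abs_nonneg (v k t - w)])
  have hGlim := tendsto_zero_of_dissipation hEderiv (fun t _ => hGderiv t)
    (fun t => Finset.sum_nonneg fun k _ => sq_nonneg _) hbelow hG'bound
  have hsq : Tendsto (fun t => (v i t - w) ^ 2) atTop (nhds 0) :=
    squeeze_zero (fun t => sq_nonneg _) (fun t =>
      Finset.single_le_sum (f := fun k => (v k t - w) ^ 2) (fun k _ => sq_nonneg _)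
        (Finset.mem_univ i)) hGlim
  have habs : Tendsto (fun t => |v i t - w|) atTop (nhds 0) := by
    simpa [sqrt_sq_eq_abs] using hsq.sqrt
  exact tendsto_sub_nhds_zero_iff.1 ((tendsto_zero_iff_abs_tendsto_zero _).2 habs)

end IsKuramotoSolution

/-- The relaxation time over which velocities are damped by the factor `μ / (lam + 2μ + 2)`. -/
lemma exists_relaxation_time {m K β μ lam : ℝ} (hm : 0 < m) (hβ : 0 < β)
    (hμ0 : 0 < μ) (hlam : μ + 2 < lam)
    (hmK : m * K ≤ β / (4 * (lam + μ + 2) * log ((lam + 2 * μ + 2) / μ))) :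
    ∃ τ, 0 ≤ τ ∧ exp (-(τ / m)) = μ / (lam + 2 * μ + 2) ∧ lam * K * τ ≤ β / 4 := by
  have hd : 0 < lam + 2 * μ + 2 := by linarith
  have hlog : 0 < log ((lam + 2 * μ + 2) / μ) := log_pos (by rw [lt_div_iff₀ hμ0]; linarith)
  refine ⟨m * log ((lam + 2 * μ + 2) / μ), by positivity, ?_, ?_⟩
  · rw [mul_div_cancel_left₀ _ hm.ne', exp_neg, exp_log (by positivity), inv_div]
  · have hd' : 0 < lam + μ + 2 := by linarith
    rw [le_div_iff₀ (by positivity)] at hmK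
    have h1 : (lam + μ + 2) * (m * K * log ((lam + 2 * μ + 2) / μ)) ≤ β / 4 := by linarith
    rcases le_or_gt 0 (m * K * log ((lam + 2 * μ + 2) / μ)) with h0 | h0 <;> nlinarith

/-- Theorem 1.8 (complete frequency synchronization): under the stated conditions
every solution of the second-order Kuramoto system with the given initial data
satisfies `θᵢ'(t) → ω` (the mean natural frequency) as `t → ∞`, for all `i`. -/
theorem kuramoto_frequency_synchronization
    (N M : ℕ) (hM0 : 0 < M) (hM : N < 2 * M) (hMN : M ≤ N)
    (m K : ℝ) (hm : 0 < m) (hK : 0 < K)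
    (α β μ lam : ℝ)
    (hβ : 0 < β) (hβα : β < α) (hαβπ : 2 * β + α < Real.pi)
    (hpos : 0 < (M : ℝ) / N * Real.sin (α / 2 - β / 4) * Real.cos (α / 2 + 5 / 8 * β)
        - (1 - (M : ℝ) / N) * Real.cos (α / 2 - β / 8))
    (hμ0 : 0 < μ)
    (hμ : μ ≤ (M : ℝ) / N * Real.sin (α / 2 - β / 4) * Real.cos (α / 2 + 5 / 8 * β)
        - (1 - (M : ℝ) / N) * Real.cos (α / 2 - β / 8))
    (hlam : lam > μ + 2)
    (hmK : m * K ≤ β / (4 * (lam + μ + 2) * Real.log ((lam + 2 * μ + 2) / μ)))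
    (ω : Fin N → ℝ) (hΩ : diam ω < μ * K)
    (θ : Fin N → ℝ → ℝ)
    (hsmooth : ∀ i, ContDiff ℝ 2 (θ i))
    (hode : ∀ i, ∀ t : ℝ, 0 ≤ t →
      m * deriv (deriv (θ i)) t + deriv (θ i) t
        = ω i + K / N * ∑ j, Real.sin (θ j t - θ i t))
    (hinit : diam (fun i : Fin M => θ (Fin.castLE hMN i) 0) ≤ Real.pi - α - β)
    (hinit' : diam (fun i : Fin M => deriv (θ (Fin.castLE hMN i)) 0) < lam * K) :
    ∀ i, Tendsto (deriv (θ i)) atTop (nhds ((1 / N : ℝ) * ∑ k, ω k)) := by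
  have hN : 0 < N := hM0.trans_le hMN
  have hsol : IsKuramotoSolution m K ω θ (fun i => deriv (θ i)) (fun i => deriv (deriv (θ i))) :=
    { phase := fun i t => ((hsmooth i).differentiable (by norm_num) t).hasDerivAt
      velocity := fun i t =>
        ((((contDiff_succ_iff_deriv (n := 1)).1 (hsmooth i)).2.2).differentiable
          (by norm_num) t).hasDerivAt
      ode := hode }
  set S : Finset (Fin N) := Finset.univ.map (Fin.castLEEmb hMN)
  have hcard : S.card = M := by simp [S]
  have hmem : ∀ i ∈ S, ∃ k : Fin M, Fin.castLE hMN k = i := by simp [S]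
  have hω : ∀ i j, ω i - ω j ≤ μ * K := fun i j => (sub_le_diam ω i j).trans hΩ.le
  obtain ⟨τ, hτ0, hexp, hτ⟩ := exists_relaxation_time hm hβ hμ0 hlam hmK
  obtain ⟨C, T, hT, hC⟩ := IsKuramotoSolution.exists_forall_abs_phase_sub_le hm hK hN hβ hβα hαβπ
    hμ0 hlam hτ0 hexp hτ hω _ hsol (S := S) rfl
    (Finset.card_pos.1 (hcard ▸ hM0)) (by rwa [hcard]) le_rfl
    (fun i hi j hj => by
      obtain ⟨i, rfl⟩ := hmem i hi
      obtain ⟨j, rfl⟩ := hmem j hj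
      exact (sub_le_diam (fun i : Fin M => θ (Fin.castLE hMN i) 0) i j).trans hinit)
    (fun i hi j hj => by
      obtain ⟨i, rfl⟩ := hmem i hi
      obtain ⟨j, rfl⟩ := hmem j hj
      exact (sub_le_diam (fun i : Fin M => deriv (θ (Fin.castLE hMN i)) 0) i j).trans_lt hinit')
  exact hsol.tendsto_velocity hm hK hN hT hC
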